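/- Let 1/2 < β < 1, ν > 0, α > 0, γ ≥ 0, t > 0, and ξ ∈ ℝ^d with |ξ| > 1. Then ∫_0^t (E_β(-ν u^β |ξ|^α (1+|ξ|^2)^(γ/2)))^2 du ≤ (1/(2β-1)) (Γ(1+β)/ν)^(1/β) · 2^((α+γ)/(2β)) · (1/(1+|ξ|^2))^((α+γ)/(2β)). -/

import Mathlib

open MeasureTheory Real

noncomputable def mittagLeffler (β x : ℝ) : ℝ :=
  ∑' j : ℕ, x ^ j / Real.Gamma (1 + β * j)

lemma gamma_lower (x M : ℝ) (hx : 1 ≤ x) (hM : 0 < M) :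
    M ^ (x - 1) * Real.exp (-M) ≤ Real.Gamma x := by
  have hx0 : 0 < x := by linarith
  rw [Real.Gamma_eq_integral hx0, ← integral_exp_neg_Ioi M, ← integral_const_mul]
  have hint := Real.GammaIntegral_convergent hx0
  calc ∫ a in Set.Ioi M, M ^ (x - 1) * Real.exp (-a)
      ≤ ∫ a in Set.Ioi M, Real.exp (-a) * a ^ (x - 1) := by
        apply setIntegral_mono_on
        · exact (integrableOn_exp_neg_Ioi M).const_mul _
        · exact hint.mono_set (Set.Ioi_subset_Ioi hM.le)
        · exact measurableSet_Ioi
        · intro a ha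
          rw [mul_comm]
          have : M ^ (x - 1) ≤ a ^ (x - 1) :=
            Real.rpow_le_rpow hM.le (le_of_lt ha) (by linarith)
          gcongr
    _ ≤ _ := by
        apply setIntegral_mono_set hint
        · filter_upwards [ae_restrict_mem measurableSet_Ioi] with a ha
          have : (0:ℝ) < a := ha
          simp only [Pi.zero_apply]
          positivity
        · exact (Set.Ioi_subset_Ioi hM.le).eventuallyLE

/-- two-parameter Mittag-Leffler function -/
noncomputable def mlG (β q x : ℝ) : ℝ := ∑' j : ℕ, x ^ j / Real.Gamma (β * j + q)

lemma ml_summable (β q x : ℝ) (hβ : 0 < β) (hq : 0 < q) :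
    Summable (fun j : ℕ => |x| ^ j / Real.Gamma (β * j + q)) := by
  set y := 2 * |x| + 1 with hy
  have hy0 : 0 < y := by positivity
  set M := y ^ (1 / β) with hM
  have hM0 : 0 < M := by positivity
  have hg : Summable (fun j : ℕ => (1 / 2 : ℝ) ^ j * (Real.exp M / M ^ (q - 1))) :=
    (summable_geometric_of_lt_one (by norm_num) (by norm_num)).mul_right _
  refine Summable.of_norm_bounded_eventually_nat hg ?_
  obtain ⟨N, hN⟩ := exists_nat_gt (1 / β)
  filter_upwards [Filter.eventually_ge_atTop N] with j hj
  have hj1 : 1 ≤ β * j := by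
    have : 1 / β ≤ j := hN.le.trans (by exact_mod_cast hj)
    rw [div_le_iff₀ hβ] at this
    linarith
  have h1 := gamma_lower (β * j + q) M (by linarith) hM0
  have h2 : M ^ (β * j + q - 1) = y ^ j * M ^ (q - 1) := by
    rw [add_sub_assoc, Real.rpow_add hM0, hM, ← Real.rpow_mul hy0.le, ← Real.rpow_natCast y j]
    congr 2
    field_simp
  rw [h2] at h1
  have hG : 0 < Real.Gamma (β * j + q) := Real.Gamma_pos_of_pos (by linarith)
  rw [Real.norm_of_nonneg (by positivity)]
  have h3 : |x| ^ j ≤ (1 / 2) ^ j * y ^ j := by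
    rw [← mul_pow]
    gcongr
    rw [hy]; linarith
  have hMq : 0 < M ^ (q - 1) := by positivity
  calc |x| ^ j / Real.Gamma (β * j + q)
      ≤ ((1 / 2) ^ j * y ^ j) / (y ^ j * M ^ (q - 1) * Real.exp (-M)) := by gcongr
    _ = _ := by
      rw [Real.exp_neg]
      field_simp

lemma ml_summable' (β q x : ℝ) (hβ : 0 < β) (hq : 0 < q) :
    Summable (fun j : ℕ => x ^ j / Real.Gamma (β * j + q)) := by
  refine Summable.of_norm_bounded (ml_summable β q x hβ hq) (fun j => ?_)
  have hG : 0 < Real.Gamma (β * j + q) := Real.Gamma_pos_of_pos (by positivity)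
  rw [norm_div, norm_pow, Real.norm_eq_abs, Real.norm_of_nonneg hG.le]

lemma ml_cont (β q : ℝ) (hβ : 0 < β) (hq : 0 < q) : Continuous (mlG β q) := by
  rw [continuous_iff_continuousAt]
  intro x
  have hc : ContinuousOn (mlG β q) (Metric.ball 0 (|x| + 1)) := by
    unfold mlG
    refine continuousOn_tsum (u := fun j : ℕ => |(|x| + 1)| ^ j / Real.Gamma (β * j + q))
      (fun j => ?_) (ml_summable β q _ hβ hq) (fun j z hz => ?_)
    · exact ((continuous_pow j).div_const _).continuousOn
    · have hG : 0 < Real.Gamma (β * j + q) := Real.Gamma_pos_of_pos (by positivity)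
      rw [norm_div, norm_pow, Real.norm_of_nonneg hG.le]
      have : ‖z‖ ≤ |(|x| + 1)| := by
        rw [mem_ball_zero_iff] at hz
        exact hz.le.trans (le_abs_self _)
      gcongr
  refine hc.continuousAt (Metric.isOpen_ball.mem_nhds ?_)
  simp

lemma ml_shift (β q x : ℝ) (hβ : 0 < β) (hq : 0 < q) :
    mlG β q x = 1 / Real.Gamma q + x * mlG β (q + β) x := by
  unfold mlG
  rw [(ml_summable' β q x hβ hq).tsum_eq_zero_add, ← tsum_mul_left]
  congr 1
  · simp
  · congr 1
    ext j
    push_cast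
    rw [show β * ((j:ℝ) + 1) + q = β * j + (q + β) by ring]
    ring

/-- the function `t^(q-1) E_{β,q}(-t^β)` -/
noncomputable def mlE (β q t : ℝ) : ℝ := t ^ (q - 1) * mlG β q (-t ^ β)

lemma mlE_shift (β q t : ℝ) (hβ : 0 < β) (hq : 0 < q) (ht : 0 < t) :
    mlE β q t = t ^ (q - 1) / Real.Gamma q - mlE β (q + β) t := by
  unfold mlE
  rw [ml_shift β q _ hβ hq, show q + β - 1 = (q - 1) + β by ring, Real.rpow_add ht]
  ring

lemma mlE_cont (β q : ℝ) (hβ : 0 < β) (hq : 0 < q) : ContinuousOn (mlE β q) (Set.Ioi 0) := by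
  unfold mlE
  refine ContinuousOn.mul ?_ ?_
  · intro t ht
    exact (Real.continuousAt_rpow_const t _ (Or.inl (ne_of_gt ht))).continuousWithinAt
  · exact ((ml_cont β q hβ hq).comp
      (continuous_id.rpow_const (fun _ => Or.inr hβ.le)).neg).continuousOn

lemma beta_real (p q t : ℝ) (hp : 0 < p) (hq : 0 < q) (ht : 0 < t) :
    ∫ s in (0:ℝ)..t, (t - s) ^ (p - 1) * s ^ (q - 1) =
      t ^ (p + q - 1) * (Real.Gamma p * Real.Gamma q / Real.Gamma (p + q)) := by
  have h := Complex.betaIntegral_scaled (q : ℂ) (p : ℂ) ht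
  rw [Complex.betaIntegral_eq_Gamma_mul_div _ _ (by simpa) (by simpa)] at h
  have h2 : ∫ x in (0:ℝ)..t, (x : ℂ) ^ ((q:ℂ) - 1) * ((t : ℂ) - x) ^ ((p:ℂ) - 1) =
      ((∫ s in (0:ℝ)..t, (t - s) ^ (p - 1) * s ^ (q - 1) : ℝ) : ℂ) := by
    rw [← intervalIntegral.integral_ofReal]
    apply intervalIntegral.integral_congr
    intro s hs
    rw [Set.uIcc_of_le ht.le] at hs
    simp only
    push_cast
    rw [Complex.ofReal_cpow (by linarith [hs.2]), Complex.ofReal_cpow hs.1]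
    push_cast
    ring
  rw [h2] at h
  apply Complex.ofReal_injective
  rw [h]
  push_cast
  rw [Complex.ofReal_cpow ht.le, ← Complex.Gamma_ofReal, ← Complex.Gamma_ofReal,
    ← Complex.Gamma_ofReal]
  push_cast
  rw [add_comm (q:ℂ) p]
  ring

lemma beta_intble (p q t : ℝ) (hp : 0 < p) (hq : 0 < q) (ht : 0 < t) :
    IntervalIntegrable (fun s => (t - s) ^ (p - 1) * s ^ (q - 1)) volume 0 t := by
  by_contra h
  have h1 := intervalIntegral.integral_undef h
  rw [beta_real p q t hp hq ht] at h1
  have := Real.Gamma_pos_of_pos hp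
  have := Real.Gamma_pos_of_pos hq
  have := Real.Gamma_pos_of_pos (add_pos hp hq)
  have : 0 < t ^ (p + q - 1) * (Real.Gamma p * Real.Gamma q / Real.Gamma (p + q)) := by positivity
  linarith

lemma conv_intble (β p q t : ℝ) (hβ : 0 < β) (hp : 0 < p) (hq : 0 < q) (ht : 0 < t) :
    IntervalIntegrable (fun s => (t - s) ^ (p - 1) * mlE β q s) volume 0 t := by
  unfold mlE
  simp_rw [← mul_assoc]
  refine (beta_intble p q t hp hq ht).mul_continuousOn ?_
  exact ((ml_cont β q hβ hq).comp
      (continuous_id.rpow_const (fun _ => Or.inr hβ.le)).neg).continuousOn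

lemma conv_eq (β p q t : ℝ) (hβ : 0 < β) (hp : 0 < p) (hq : 0 < q) (ht : 0 < t) :
    ∫ s in (0:ℝ)..t, (t - s) ^ (p - 1) * mlE β q s = Real.Gamma p * mlE β (p + q) t := by
  have hGp := Real.Gamma_pos_of_pos hp
  set F : ℕ → ℝ → ℝ := fun j s =>
    ((-1) ^ j / Real.Gamma (β * j + q)) * ((t - s) ^ (p - 1) * s ^ (β * j + q - 1)) with hF
  have hqj : ∀ j : ℕ, 0 < β * j + q := fun j => by positivity
  have hGj : ∀ j : ℕ, 0 < Real.Gamma (β * j + q) := fun j => Real.Gamma_pos_of_pos (hqj j)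
  have hint : ∀ j, Integrable (F j) (volume.restrict (Set.Ioc 0 t)) := fun j => by
    have := (beta_intble p (β * j + q) t hp (hqj j) ht).const_mul
      ((-1) ^ j / Real.Gamma (β * j + q))
    rwa [intervalIntegrable_iff_integrableOn_Ioc_of_le ht.le] at this
  have hnorm : ∀ j : ℕ, ∫ s in Set.Ioc 0 t, ‖F j s‖ =
      Real.Gamma p * t ^ (p + q - 1) * (|t ^ β| ^ j / Real.Gamma (β * j + (p + q))) := fun j => by
    have h1 : ∫ s in Set.Ioc 0 t, ‖F j s‖ = ∫ s in Set.Ioc 0 t,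
        (1 / Real.Gamma (β * j + q)) * ((t - s) ^ (p - 1) * s ^ (β * j + q - 1)) := by
      apply setIntegral_congr_fun measurableSet_Ioc
      intro s hs
      have hs0 : 0 ≤ t - s := by linarith [hs.2]
      have hs1 : 0 ≤ s := hs.1.le
      simp only [hF]
      rw [norm_mul, norm_div, norm_pow, norm_neg, norm_one, one_pow,
        Real.norm_of_nonneg (hGj j).le, Real.norm_of_nonneg (by positivity)]
    rw [h1, integral_const_mul, ← intervalIntegral.integral_of_le ht.le,
      beta_real p _ t hp (hqj j) ht, show p + (β * j + q) = β * j + (p + q) by ring,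
      show β * j + (p + q) - 1 = β * j + (p + q - 1) by ring, Real.rpow_add ht,
      Real.rpow_mul ht.le, Real.rpow_natCast, abs_of_pos (by positivity)]
    have := hGj j
    field_simp
  have hval : ∀ j : ℕ, ∫ s in Set.Ioc 0 t, F j s =
      Real.Gamma p * t ^ (p + q - 1) * ((-t ^ β) ^ j / Real.Gamma (β * j + (p + q))) := fun j => by
    simp only [hF]
    rw [integral_const_mul, ← intervalIntegral.integral_of_le ht.le,
      beta_real p _ t hp (hqj j) ht, show p + (β * j + q) = β * j + (p + q) by ring,
      show β * j + (p + q) - 1 = β * j + (p + q - 1) by ring, Real.rpow_add ht,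
      Real.rpow_mul ht.le, Real.rpow_natCast, neg_pow (t ^ β)]
    have := hGj j
    field_simp
  have hsum := hasSum_integral_of_summable_integral_norm hint (by
    simp_rw [hnorm]
    exact (ml_summable β (p + q) _ hβ (by positivity)).mul_left _)
  have h3 := hsum.tsum_eq
  simp_rw [hval] at h3
  rw [tsum_mul_left] at h3
  have h4 : ∫ s in Set.Ioc 0 t, ∑' j, F j s = ∫ s in Set.Ioc 0 t, (t - s) ^ (p - 1) * mlE β q s := by
    apply setIntegral_congr_fun measurableSet_Ioc
    intro s hs
    have hs0 : 0 < s := hs.1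
    simp only [hF, mlE, mlG]
    rw [← mul_assoc, ← tsum_mul_left]
    congr 1
    ext j
    rw [show β * j + q - 1 = β * j + (q - 1) by ring, Real.rpow_add hs0,
      Real.rpow_mul hs0.le, Real.rpow_natCast, neg_pow (s ^ β)]
    ring
  rw [intervalIntegral.integral_of_le ht.le, ← h4, ← h3, mlE, mlG]
  ring

lemma mlE_pos_aux (β : ℝ) (hβ : 0 < β) (hβ1 : β < 1) (t0 : ℝ) (ht0 : 0 < t0)
    (hpos : ∀ s, 0 < s → s < t0 → 0 < mlE β β s) : 0 < mlE β β t0 := by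
  by_contra hcon
  rw [not_lt] at hcon
  have hΓ := Real.Gamma_pos_of_pos hβ
  have hvol : ∀ t, 0 < t → Real.Gamma β * mlE β β t =
      t ^ (β - 1) - ∫ s in (0:ℝ)..t, (t - s) ^ (β - 1) * mlE β β s := fun t ht => by
    rw [conv_eq β β β t hβ hβ hβ ht, mlE_shift β β t hβ hβ ht]
    field_simp
  have hev : ∀ᶠ t1 in nhds t0, t1 ^ (β - 1) * ((t0 - t1) ^ β / β) <
      t0 ^ (β - 1) * Real.Gamma β := by
    have hc : ContinuousAt (fun t1 : ℝ => t1 ^ (β - 1) * ((t0 - t1) ^ β / β)) t0 := by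
      refine ContinuousAt.mul (Real.continuousAt_rpow_const _ _ (Or.inl ht0.ne')) ?_
      refine ContinuousAt.div_const ?_ _
      exact ((continuous_const.sub continuous_id).rpow_const (fun _ => Or.inr hβ.le)).continuousAt
    refine hc.eventually_lt continuousAt_const ?_
    rw [sub_self, Real.zero_rpow hβ.ne']
    simp only [zero_div, mul_zero]
    positivity
  obtain ⟨ε, hε, hball⟩ := Metric.eventually_nhds_iff.mp hev
  set ts := max (t0 - ε / 2) (t0 / 2) with hts
  have hts0 : 0 < ts := lt_of_lt_of_le (by linarith) (le_max_right _ _)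
  have hts1 : ts < t0 := max_lt (by linarith) (by linarith)
  obtain ⟨t1, ht1m, ht1max⟩ := (isCompact_Icc (a := ts) (b := t0)).exists_isMaxOn
    ⟨ts, le_refl _, hts1.le⟩ ((mlE_cont β β hβ hβ).mono (fun s hs => lt_of_lt_of_le hts0 hs.1))
  have hr1 : 0 < mlE β β t1 :=
    lt_of_lt_of_le (hpos ts hts0 hts1) (ht1max ⟨le_refl _, hts1.le⟩)
  have ht1 : 0 < t1 := lt_of_lt_of_le hts0 ht1m.1
  have ht1lt : t1 < t0 := by
    rcases ht1m.2.lt_or_eq with h | h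
    · exact h
    · rw [h] at hr1; linarith
  have hP := hball (y := t1) (by
    rw [Real.dist_eq, abs_lt]
    have := le_max_left (t0 - ε / 2) (t0 / 2)
    constructor <;> linarith [ht1m.1])
  have hi0 := conv_intble β β β t0 hβ hβ hβ ht0
  have hi1 := conv_intble β β β t1 hβ hβ hβ ht1
  have hi0a : IntervalIntegrable (fun s => (t0 - s) ^ (β - 1) * mlE β β s) volume 0 t1 :=
    hi0.mono_set (by
      rw [Set.uIcc_of_le ht1.le, Set.uIcc_of_le ht0.le]
      exact Set.Icc_subset_Icc_right ht1lt.le)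
  have hi0b : IntervalIntegrable (fun s => (t0 - s) ^ (β - 1) * mlE β β s) volume t1 t0 :=
    hi0.mono_set (by
      rw [Set.uIcc_of_le ht1lt.le, Set.uIcc_of_le ht0.le]
      exact Set.Icc_subset_Icc_left ht1.le)
  have hsplit := intervalIntegral.integral_add_adjacent_intervals hi0a hi0b
  have hv0 := hvol t0 ht0
  have hv1 := hvol t1 ht1
  have hJ : t1 ^ (β - 1) * ∫ s in (0:ℝ)..t1, (t0 - s) ^ (β - 1) * mlE β β s ≤
      t0 ^ (β - 1) * ∫ s in (0:ℝ)..t1, (t1 - s) ^ (β - 1) * mlE β β s := by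
    rw [← intervalIntegral.integral_const_mul, ← intervalIntegral.integral_const_mul]
    refine intervalIntegral.integral_mono_on_of_le_Ioo ht1.le (hi0a.const_mul _)
      (hi1.const_mul _) (fun s hs => ?_)
    have hrs := hpos s hs.1 (hs.2.trans ht1lt)
    rw [← mul_assoc, ← mul_assoc]
    refine mul_le_mul_of_nonneg_right ?_ hrs.le
    have h1 : 0 < t1 - s := by linarith [hs.2]
    have h0 : 0 < t0 - s := by linarith
    rw [← Real.mul_rpow ht1.le h0.le, ← Real.mul_rpow ht0.le h1.le]
    refine Real.rpow_le_rpow_of_nonpos (by positivity) ?_ (by linarith)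
    nlinarith [hs.1]
  have hK : ∫ s in t1..t0, (t0 - s) ^ (β - 1) * mlE β β s ≤
      mlE β β t1 * ((t0 - t1) ^ β / β) := by
    have hki : IntervalIntegrable (fun s => (t0 - s) ^ (β - 1)) volume t1 t0 := by
      have := (intervalIntegral.intervalIntegrable_rpow' (a := t0 - t1) (b := 0)
        (r := β - 1) (by linarith)).comp_sub_left t0
      simpa using this
    have hkv : ∫ s in t1..t0, (t0 - s) ^ (β - 1) = (t0 - t1) ^ β / β := by
      rw [intervalIntegral.integral_comp_sub_left (fun x => x ^ (β - 1)) t0, sub_self,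
        integral_rpow (Or.inl (by linarith))]
      simp [Real.zero_rpow hβ.ne']
    rw [← hkv, ← intervalIntegral.integral_const_mul]
    refine intervalIntegral.integral_mono_on ht1lt.le hi0b (hki.const_mul _) (fun s hs => ?_)
    rw [mul_comm (mlE β β t1)]
    have h0 : 0 ≤ t0 - s := by linarith [hs.2]
    exact mul_le_mul_of_nonneg_left (ht1max ⟨ht1m.1.trans hs.1, hs.2⟩) (by positivity)
  have hA : 0 < t1 ^ (β - 1) := by positivity
  have hB : 0 < t0 ^ (β - 1) := by positivity
  rw [← hsplit] at hv0
  have hL : Real.Gamma β * mlE β β t0 ≤ 0 := mul_nonpos_of_nonneg_of_nonpos hΓ.le hcon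
  have h1 := mul_le_mul_of_nonneg_left hK hA.le
  have h2 := mul_lt_mul_of_pos_right hP hr1
  have h3 := mul_nonpos_of_nonneg_of_nonpos hA.le hL
  rw [hv0] at h3
  have h4 : ∫ s in (0:ℝ)..t1, (t1 - s) ^ (β - 1) * mlE β β s =
    t1 ^ (β - 1) - Real.Gamma β * mlE β β t1 := by linarith
  rw [h4] at hJ
  nlinarith

lemma mlE_pos (β : ℝ) (hβ : 0 < β) (hβ1 : β < 1) (t : ℝ) (ht : 0 < t) : 0 < mlE β β t := by
  have hΓ := Real.Gamma_pos_of_pos hβ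
  set g : ℝ → ℝ := fun s => mlG β β (-s ^ β) with hg
  have hgc : Continuous g := (ml_cont β β hβ hβ).comp
      (continuous_id.rpow_const (fun _ => Or.inr hβ.le)).neg
  have hg0 : 0 < g 0 := by
    simp only [hg]
    rw [Real.zero_rpow hβ.ne', neg_zero, ml_shift β β 0 hβ hβ]
    simp [hΓ]
  have hiff : ∀ s, 0 < s → (0 < mlE β β s ↔ 0 < g s) := fun s hs => by
    unfold mlE
    exact mul_pos_iff_of_pos_left (by positivity)
  obtain ⟨δ, hδ, hball⟩ := Metric.eventually_nhds_iff.mp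
    (hgc.continuousAt.eventually (lt_mem_nhds hg0))
  by_contra hcon
  set S : Set ℝ := Set.Ici δ ∩ g ⁻¹' Set.Iic 0 with hS
  have hSc : IsClosed S := isClosed_Ici.inter (isClosed_Iic.preimage hgc)
  have hmem : ∀ s, 0 < s → ¬ 0 < mlE β β s → s ∈ S := fun s hs h => by
    rw [hiff s hs] at h
    refine ⟨?_, not_lt.mp h⟩
    by_contra h2
    refine h (hball ?_)
    rw [Real.dist_eq, sub_zero, abs_of_pos hs]
    exact not_le.mp h2
  have hSb : BddBelow S := ⟨δ, fun s hs => hs.1⟩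
  have h0 := hSc.csInf_mem ⟨t, hmem t ht hcon⟩ hSb
  have hpos0 : 0 < sInf S := lt_of_lt_of_le hδ h0.1
  have := mlE_pos_aux β hβ hβ1 (sInf S) hpos0 (fun s hs hlt => by
    by_contra h
    exact absurd (csInf_le hSb (hmem s hs h)) (not_le.mpr hlt))
  rw [hiff _ hpos0] at this
  exact absurd h0.2 (not_le.mpr this)

lemma mlE_one_nonneg (β : ℝ) (hβ : 0 < β) (hβ1 : β < 1) (t : ℝ) (ht : 0 < t) :
    0 ≤ mlE β 1 t := by
  have h := conv_eq β (1 - β) β t hβ (by linarith) hβ ht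
  rw [sub_add_cancel] at h
  have hΓ := Real.Gamma_pos_of_pos (show 0 < 1 - β by linarith)
  refine nonneg_of_mul_nonneg_right (a := Real.Gamma (1 - β)) ?_ hΓ
  rw [← h, intervalIntegral.integral_of_le ht.le]
  refine setIntegral_nonneg measurableSet_Ioc (fun s hs => ?_)
  have h1 := mlE_pos β hβ hβ1 s hs.1
  have h0 : 0 ≤ t - s := by linarith [hs.2]
  positivity

lemma mlE_one_anti (β : ℝ) (hβ : 0 < β) (hβ1 : β < 1) (s t : ℝ) (hs : 0 < s) (hst : s ≤ t) :
    mlE β 1 t ≤ mlE β 1 s := by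
  have ht : 0 < t := lt_of_lt_of_le hs hst
  have h := fun u hu => conv_eq β 1 β u hβ one_pos hβ hu
  have hi := conv_intble β 1 β t hβ one_pos hβ ht
  simp only [sub_self, Real.rpow_zero, one_mul, Real.Gamma_one] at h hi
  rw [mlE_shift β 1 t hβ one_pos ht, mlE_shift β 1 s hβ one_pos hs, ← h t ht, ← h s hs]
  simp only [sub_self, Real.rpow_zero]
  have : ∫ u in (0:ℝ)..s, mlE β β u ≤ ∫ u in (0:ℝ)..t, mlE β β u := by
    refine intervalIntegral.integral_mono_interval le_rfl hs.le hst ?_ hi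
    filter_upwards [ae_restrict_mem measurableSet_Ioc] with u hu
    exact (mlE_pos β hβ hβ1 u hu.1).le
  linarith

lemma mlE_one_bound (β : ℝ) (hβ : 0 < β) (hβ1 : β < 1) (t : ℝ) (ht : 0 < t) :
    mlE β 1 t * (1 + t ^ β / Real.Gamma (1 + β)) ≤ 1 := by
  have hΓ := Real.Gamma_pos_of_pos hβ
  have h := conv_eq β β 1 t hβ hβ one_pos ht
  have hi := conv_intble β β 1 t hβ hβ one_pos ht
  have hki : IntervalIntegrable (fun s => (t - s) ^ (β - 1)) volume 0 t := by
    have := (intervalIntegral.intervalIntegrable_rpow' (a := t) (b := 0)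
      (r := β - 1) (by linarith)).comp_sub_left t
    simpa using this
  have hkv : ∫ s in (0:ℝ)..t, (t - s) ^ (β - 1) = t ^ β / β := by
    rw [intervalIntegral.integral_comp_sub_left (fun x => x ^ (β - 1)) t, sub_self,
      integral_rpow (Or.inl (by linarith))]
    simp [Real.zero_rpow hβ.ne']
  have hle : mlE β 1 t * (t ^ β / β) ≤ Real.Gamma β * mlE β (β + 1) t := by
    rw [← h, ← hkv, ← intervalIntegral.integral_const_mul]
    refine intervalIntegral.integral_mono_on_of_le_Ioo ht.le (hki.const_mul _) hi (fun s hs => ?_)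
    rw [mul_comm]
    have h0 : 0 ≤ t - s := by linarith [hs.2]
    exact mul_le_mul_of_nonneg_left (mlE_one_anti β hβ hβ1 s t hs.1 hs.2.le) (by positivity)
  have hsh := mlE_shift β 1 t hβ one_pos ht
  simp only [sub_self, Real.rpow_zero, Real.Gamma_one, div_one] at hsh
  rw [add_comm 1 β] at hsh ⊢
  rw [Real.Gamma_add_one hβ.ne']
  have : mlE β 1 t * (t ^ β / (β * Real.Gamma β)) ≤ mlE β (β + 1) t := by
    rw [← mul_le_mul_iff_right₀ hΓ]
    refine le_trans (le_of_eq ?_) hle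
    field_simp
  linarith

lemma ml_bound (β : ℝ) (hβ : 0 < β) (hβ1 : β < 1) (x : ℝ) (hx : 0 ≤ x) :
    0 ≤ mlG β 1 (-x) ∧ mlG β 1 (-x) ≤ 1 / (1 + x / Real.Gamma (1 + β)) := by
  rcases hx.eq_or_lt with rfl | hx
  · rw [neg_zero, ml_shift β 1 0 hβ one_pos]
    simp
  · set t := x ^ (1 / β) with ht
    have ht0 : 0 < t := by positivity
    have htx : t ^ β = x := by
      rw [ht, ← Real.rpow_mul hx.le, one_div_mul_cancel hβ.ne', Real.rpow_one]
    have he : mlE β 1 t = mlG β 1 (-x) := by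
      rw [mlE, htx]; simp
    have h1 := mlE_one_nonneg β hβ hβ1 t ht0
    have h2 := mlE_one_bound β hβ hβ1 t ht0
    rw [he] at h1 h2
    rw [htx] at h2
    have hΓ := Real.Gamma_pos_of_pos (show 0 < 1 + β by linarith)
    exact ⟨h1, (le_div_iff₀ (by positivity)).mpr h2⟩

lemma mittagLeffler_eq (β x : ℝ) : mittagLeffler β x = mlG β 1 x := by
  unfold mittagLeffler mlG
  simp_rw [add_comm]

lemma integral_bound (β a t : ℝ) (hβ : 1 / 2 < β) (hβ1 : β < 1) (ha : 0 < a) (ht : 0 < t) :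
    ∫ u in (0:ℝ)..t, (mlG β 1 (-(a * u ^ β))) ^ 2 ≤
      (1 / (2 * β - 1)) * (Real.Gamma (1 + β) / a) ^ (1 / β) := by
  have hβ0 : 0 < β := by linarith
  have hΓ := Real.Gamma_pos_of_pos (show 0 < 1 + β by linarith)
  set c := (a / Real.Gamma (1 + β)) ^ (1 / β) with hc
  have hc0 : 0 < c := by positivity
  have hcβ : c ^ β = a / Real.Gamma (1 + β) := by
    rw [hc, ← Real.rpow_mul (by positivity), one_div_mul_cancel hβ0.ne', Real.rpow_one]
  have hcinv : (Real.Gamma (1 + β) / a) ^ (1 / β) = c⁻¹ := by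
    rw [hc, ← Real.inv_rpow (by positivity), inv_div]
  have h1 : ∫ u in (0:ℝ)..t, (mlG β 1 (-(a * u ^ β))) ^ 2 ≤
      ∫ u in (0:ℝ)..t, (c * u + 1) ^ (-(2 * β)) := by
    refine intervalIntegral.integral_mono_on ht.le ?_ ?_ (fun u hu => ?_)
    · refine Continuous.intervalIntegrable ?_ _ _
      exact ((ml_cont β 1 hβ0 one_pos).comp (continuous_const.mul
        (continuous_id.rpow_const (fun _ => Or.inr hβ0.le))).neg).pow 2
    · refine ContinuousOn.intervalIntegrable ?_
      rw [Set.uIcc_of_le ht.le]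
      refine ContinuousOn.rpow_const (by fun_prop) (fun u hu => Or.inl ?_)
      have : 0 ≤ c * u := mul_nonneg hc0.le hu.1
      positivity
    · have hu0 : 0 ≤ u := hu.1
      obtain ⟨hn, hb⟩ := ml_bound β hβ0 hβ1 (a * u ^ β) (by positivity)
      have hs := Real.rpow_add_le_add_rpow (show 0 ≤ c * u by positivity) zero_le_one hβ0.le hβ1.le
      rw [Real.one_rpow, Real.mul_rpow hc0.le hu0, hcβ] at hs
      have hp : 0 < (c * u + 1) ^ β := by positivity
      have hb2 : mlG β 1 (-(a * u ^ β)) ≤ ((c * u + 1) ^ β)⁻¹ := by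
        refine hb.trans ?_
        rw [one_div]
        refine inv_anti₀ hp (hs.trans (le_of_eq ?_))
        ring
      rw [Real.rpow_neg (by positivity), mul_comm 2 β, Real.rpow_mul (by positivity),
        Real.rpow_two, ← inv_pow]
      exact pow_le_pow_left₀ hn hb2 2
  refine h1.trans ?_
  have hct : 0 < c * t := by positivity
  rw [intervalIntegral.integral_comp_mul_add (fun x => x ^ (-(2 * β))) hc0.ne' 1, hcinv,
    integral_rpow (Or.inr ⟨by linarith, by
      rw [Set.uIcc_of_le (by linarith)]
      intro h
      have := h.1
      norm_num at this⟩)]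
  simp only [mul_zero, zero_add, Real.one_rpow, smul_eq_mul]
  rw [mul_comm]
  refine mul_le_mul_of_nonneg_right ?_ (by positivity)
  have hd : 0 < 2 * β - 1 := by linarith
  rw [show -(2 * β) + 1 = -(2 * β - 1) by ring, div_neg, ← neg_div]
  gcongr
  have : 0 < (c * t + 1) ^ (-(2 * β - 1)) := by positivity
  linarith

theorem Nt_bound_large_beta (d : ℕ) (β ν α γ t : ℝ) (ξ : EuclideanSpace ℝ (Fin d))
    (hβ : 1 / 2 < β) (hβ1 : β < 1) (hν : 0 < ν) (hα : 0 < α) (hγ : 0 ≤ γ)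
    (ht : 0 < t) (hξ : 1 < ‖ξ‖) :
    ∫ u in (0:ℝ)..t,
        (mittagLeffler β (-(ν * u ^ β * ‖ξ‖ ^ α * (1 + ‖ξ‖ ^ 2) ^ (γ / 2)))) ^ 2
      ≤ (1 / (2 * β - 1)) * (Real.Gamma (1 + β) / ν) ^ (1 / β) * 2 ^ ((α + γ) / (2 * β))
          * (1 / (1 + ‖ξ‖ ^ 2)) ^ ((α + γ) / (2 * β)) := by
  have hβ0 : 0 < β := by linarith
  have hΓ := Real.Gamma_pos_of_pos (show 0 < 1 + β by linarith)
  have hn : 0 < ‖ξ‖ := by linarith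
  set a := ν * ‖ξ‖ ^ α * (1 + ‖ξ‖ ^ 2) ^ (γ / 2) with ha
  have ha0 : 0 < a := by positivity
  have h1 := integral_bound β a t hβ hβ1 ha0 ht
  have h2 : ∫ u in (0:ℝ)..t,
      (mittagLeffler β (-(ν * u ^ β * ‖ξ‖ ^ α * (1 + ‖ξ‖ ^ 2) ^ (γ / 2)))) ^ 2 =
      ∫ u in (0:ℝ)..t, (mlG β 1 (-(a * u ^ β))) ^ 2 := by
    congr 1
    ext u
    rw [mittagLeffler_eq, ha]
    congr 3
    ring
  rw [h2]
  refine h1.trans ?_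
  have hd : 0 < 2 * β - 1 := by linarith
  rw [mul_assoc, mul_assoc]
  refine mul_le_mul_of_nonneg_left ?_ (by positivity)
  set w := 1 + ‖ξ‖ ^ 2 with hw
  have hw0 : 0 < w := by positivity
  have ha1 : ν * (w / 2) ^ ((α + γ) / 2) ≤ a := by
    rw [ha, mul_assoc, add_div α γ 2, Real.rpow_add (by positivity)]
    have e1 : (w / 2) ^ (α / 2) ≤ ‖ξ‖ ^ α := by
      have : ‖ξ‖ ^ α = (‖ξ‖ ^ 2) ^ (α / 2) := by
        rw [← Real.rpow_two, ← Real.rpow_mul hn.le]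
        congr 1
        ring
      rw [this]
      refine Real.rpow_le_rpow (by positivity) ?_ (by positivity)
      rw [hw]; nlinarith
    have e2 : (w / 2) ^ (γ / 2) ≤ w ^ (γ / 2) :=
      Real.rpow_le_rpow (by positivity) (by linarith) (by positivity)
    gcongr
  calc (Real.Gamma (1 + β) / a) ^ (1 / β)
      ≤ (Real.Gamma (1 + β) / (ν * (w / 2) ^ ((α + γ) / 2))) ^ (1 / β) := by
        refine Real.rpow_le_rpow (by positivity) ?_ (by positivity)
        gcongr
    _ = ((Real.Gamma (1 + β) / ν) * (2 * (1 / w)) ^ ((α + γ) / 2)) ^ (1 / β) := by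
        congr 1
        rw [show 2 * (1 / w) = (w / 2)⁻¹ by field_simp, Real.inv_rpow (by positivity)]
        field_simp
    _ = _ := by
        rw [Real.mul_rpow (by positivity) (by positivity), ← Real.rpow_mul (by positivity),
          show (α + γ) / 2 * (1 / β) = (α + γ) / (2 * β) by field_simp,
          Real.mul_rpow (by norm_num) (by positivity)]
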